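/- arXiv:1604.02112 — 3 statements merged into one kernel-verified Lean document; each statement's English description precedes it below -/
import Mathlib

section
/- Fix p > 0, h > 0, a real number x_j, and set x_i = x_j + (i − j)h for integers i, s = sinh(ph), c = cosh(ph), e = p/(2(phc − s)), a = phc/(phc − s), b = (p/2)·[c(c−1) + s²]/[(phc − s)(1 − c)], c₁ = (1/4)·[exp(−ph)(1 − c) + s(exp(−ph) − 1)]/[(phc − s)(1 − c)], d = (1/4)·[exp(ph)(c − 1) + s(exp(ph) − 1)]/[(phc − s)(1 − c)]. Define B_j : ℝ → ℝ piecewise by: B_j(x) = e(x_{j−2} − x) − (e/p)sinh(p(x_{j−2} − x)) on [x_{j−2}, x_{j−1}]; B_j(x) = a + b(x_j − x) + c₁exp(p(x_j − x)) + d·exp(−p(x_j − x)) on [x_{j−1}, x_j]; B_j(x) = a + b(x − x_j) + c₁exp(p(x − x_j)) + d·exp(−p(x − x_j)) on [x_j, x_{j+1}]; B_j(x) = e(x − x_{j+2}) − (e/p)sinh(p(x − x_{j+2})) on [x_{j+1}, x_{j+2}]; and B_j(x) = 0 otherwise. Then B_j is well defined (the pieces agree on overlapping knots) and is twice continuously differentiable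 on all of ℝ. -/
/-- Coefficient `e = p/(2(phc - s))` of the exponential B-spline,
where `s = sinh(ph)`, `c = cosh(ph)`. -/
noncomputable def eCoef (p h : ℝ) : ℝ :=
  p / (2 * (p * h * Real.cosh (p * h) - Real.sinh (p * h)))

/-- Coefficient `a = phc/(phc - s)` of the exponential B-spline. -/
noncomputable def aCoef (p h : ℝ) : ℝ :=
  p * h * Real.cosh (p * h) / (p * h * Real.cosh (p * h) - Real.sinh (p * h))

/-- Coefficient `b = (p/2)·[c(c-1) + s²]/[(phc - s)(1 - c)]` of the exponential B-spline. -/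
noncomputable def bCoef (p h : ℝ) : ℝ :=
  (p / 2) * ((Real.cosh (p * h) * (Real.cosh (p * h) - 1) + Real.sinh (p * h) ^ 2) /
    ((p * h * Real.cosh (p * h) - Real.sinh (p * h)) * (1 - Real.cosh (p * h))))

/-- Coefficient `c₁ = (1/4)·[exp(-ph)(1 - c) + s(exp(-ph) - 1)]/[(phc - s)(1 - c)]`. -/
noncomputable def c1Coef (p h : ℝ) : ℝ :=
  (1 / 4) * ((Real.exp (-(p * h)) * (1 - Real.cosh (p * h)) +
      Real.sinh (p * h) * (Real.exp (-(p * h)) - 1)) /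
    ((p * h * Real.cosh (p * h) - Real.sinh (p * h)) * (1 - Real.cosh (p * h))))

/-- Coefficient `d = (1/4)·[exp(ph)(c - 1) + s(exp(ph) - 1)]/[(phc - s)(1 - c)]`. -/
noncomputable def dCoef (p h : ℝ) : ℝ :=
  (1 / 4) * ((Real.exp (p * h) * (Real.cosh (p * h) - 1) +
      Real.sinh (p * h) * (Real.exp (p * h) - 1)) /
    ((p * h * Real.cosh (p * h) - Real.sinh (p * h)) * (1 - Real.cosh (p * h))))

/-- Piece of `B_j` on `[x_{j-2}, x_{j-1}]`: `e(x_{j-2} - x) - (e/p) sinh(p(x_{j-2} - x))`. -/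
noncomputable def splinePiece1 (p h xj x : ℝ) : ℝ :=
  eCoef p h * ((xj - 2 * h) - x) - (eCoef p h / p) * Real.sinh (p * ((xj - 2 * h) - x))

/-- Piece of `B_j` on `[x_{j-1}, x_j]`:
`a + b(x_j - x) + c₁ exp(p(x_j - x)) + d exp(-p(x_j - x))`. -/
noncomputable def splinePiece2 (p h xj x : ℝ) : ℝ :=
  aCoef p h + bCoef p h * (xj - x) + c1Coef p h * Real.exp (p * (xj - x)) +
    dCoef p h * Real.exp (-(p * (xj - x)))

/-- Piece of `B_j` on `[x_j, x_{j+1}]`: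
`a + b(x - x_j) + c₁ exp(p(x - x_j)) + d exp(-p(x - x_j))`. -/
noncomputable def splinePiece3 (p h xj x : ℝ) : ℝ :=
  aCoef p h + bCoef p h * (x - xj) + c1Coef p h * Real.exp (p * (x - xj)) +
    dCoef p h * Real.exp (-(p * (x - xj)))

/-- Piece of `B_j` on `[x_{j+1}, x_{j+2}]`: `e(x - x_{j+2}) - (e/p) sinh(p(x - x_{j+2}))`. -/
noncomputable def splinePiece4 (p h xj x : ℝ) : ℝ :=
  eCoef p h * (x - (xj + 2 * h)) - (eCoef p h / p) * Real.sinh (p * (x - (xj + 2 * h)))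

open scoped Classical in
/-- The exponential B-spline `B_j` with tension parameter `p`, mesh size `h`, centered
at the knot `x_j` (so `x_{j+i} = x_j + i h`), defined piecewise and vanishing outside
`[x_{j-2}, x_{j+2}]`. -/
noncomputable def expBSpline (p h xj : ℝ) (x : ℝ) : ℝ :=
  if xj - 2 * h ≤ x ∧ x ≤ xj - h then splinePiece1 p h xj x
  else if xj - h ≤ x ∧ x ≤ xj then splinePiece2 p h xj x
  else if xj ≤ x ∧ x ≤ xj + h then splinePiece3 p h xj x
  else if xj + h ≤ x ∧ x ≤ xj + 2 * h then splinePiece4 p h xj x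
  else 0

/-- The second and third functions are the first and second derivatives of the first one,
and the second derivative is continuous. -/
structure IsTwoJet (F F' F'' : ℝ → ℝ) : Prop where
  hasDerivAt : ∀ x, HasDerivAt F (F' x) x
  hasDerivAt' : ∀ x, HasDerivAt F' (F'' x) x
  continuous : Continuous F''

/-- The function equal to `f` on `(-∞, t]` and to `g` on `(t, ∞)`. -/
noncomputable def glueAt (t : ℝ) (f g : ℝ → ℝ) (x : ℝ) : ℝ :=
  if x ≤ t then f x else g x

theorem glueAt_of_le {t x : ℝ} (f g : ℝ → ℝ) (hx : x ≤ t) : glueAt t f g x = f x :=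
  if_pos hx

theorem glueAt_of_ge {t x : ℝ} {f g : ℝ → ℝ} (h : f t = g t) (hx : t ≤ x) :
    glueAt t f g x = g x := by
  rcases hx.eq_or_lt with rfl | hx
  · rw [glueAt_of_le _ _ le_rfl, h]
  · exact if_neg hx.not_ge

theorem hasDerivAt_glueAt {t : ℝ} {f f' g g' : ℝ → ℝ} (hf : ∀ x, HasDerivAt f (f' x) x)
    (hg : ∀ x, HasDerivAt g (g' x) x) (h : f t = g t) (h' : f' t = g' t) (x : ℝ) :
    HasDerivAt (glueAt t f g) (glueAt t f' g' x) x := by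
  rcases lt_trichotomy x t with hx | rfl | hx
  · rw [glueAt_of_le _ _ hx.le]
    refine (hf x).congr_of_eventuallyEq ?_
    filter_upwards [Iic_mem_nhds hx] with y hy using glueAt_of_le _ _ hy
  · have hl : HasDerivWithinAt (glueAt x f g) (glueAt x f' g' x) (Set.Iic x) x := by
      rw [glueAt_of_le _ _ le_rfl]
      exact (hf x).hasDerivWithinAt.congr_of_mem (fun y hy => glueAt_of_le _ _ hy) Set.self_mem_Iic
    have hr : HasDerivWithinAt (glueAt x f g) (glueAt x f' g' x) (Set.Ici x) x := by
      rw [glueAt_of_ge h' le_rfl]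
      exact (hg x).hasDerivWithinAt.congr_of_mem (fun y hy => glueAt_of_ge h hy) Set.self_mem_Ici
    simpa [Set.Iic_union_Ici] using hl.union hr
  · rw [glueAt_of_ge h' hx.le]
    refine (hg x).congr_of_eventuallyEq ?_
    filter_upwards [Ici_mem_nhds hx] with y hy using glueAt_of_ge h hy

namespace IsTwoJet

variable {F F' F'' G G' G'' : ℝ → ℝ}

theorem zero : IsTwoJet (fun _ => 0) (fun _ => 0) (fun _ => 0) where
  hasDerivAt x := hasDerivAt_const x 0
  hasDerivAt' x := hasDerivAt_const x 0
  continuous := continuous_const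

theorem contDiff (hF : IsTwoJet F F' F'') : ContDiff ℝ 2 F := by
  have hd : deriv F = F' := funext fun x => (hF.hasDerivAt x).deriv
  have hd' : deriv F' = F'' := funext fun x => (hF.hasDerivAt' x).deriv
  rw [show (2 : WithTop ℕ∞) = 1 + 1 from one_add_one_eq_two.symm, contDiff_succ_iff_deriv, hd,
    contDiff_one_iff_deriv, hd']
  exact ⟨fun x => (hF.hasDerivAt x).differentiableAt, by simp,
    fun x => (hF.hasDerivAt' x).differentiableAt, hF.continuous⟩

theorem glue {t : ℝ} (hF : IsTwoJet F F' F'') (hG : IsTwoJet G G' G'') (h : F t = G t)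
    (h' : F' t = G' t) (h'' : F'' t = G'' t) :
    IsTwoJet (glueAt t F G) (glueAt t F' G') (glueAt t F'' G'') where
  hasDerivAt := hasDerivAt_glueAt hF.hasDerivAt hG.hasDerivAt h h'
  hasDerivAt' := hasDerivAt_glueAt hF.hasDerivAt' hG.hasDerivAt' h' h''
  continuous := hF.continuous.if_le hG.continuous continuous_id continuous_const
    fun x hx => by subst hx; exact h''

theorem comp_const_sub (hF : IsTwoJet F F' F'') (r : ℝ) :
    IsTwoJet (fun x => F (r - x)) (fun x => -F' (r - x)) (fun x => F'' (r - x)) where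
  hasDerivAt x := (hF.hasDerivAt (r - x)).comp_const_sub r x
  hasDerivAt' x := by
    simpa only [neg_neg] using ((hF.hasDerivAt' (r - x)).comp_const_sub r x).fun_neg
  continuous := hF.continuous.comp (continuous_const.sub continuous_id)

end IsTwoJet

theorem splinePiece1_eq (p h xj x : ℝ) :
    splinePiece1 p h xj x = splinePiece4 p h xj (2 * xj - x) := by
  simp only [splinePiece1, splinePiece4]
  ring_nf

theorem splinePiece2_eq (p h xj x : ℝ) :
    splinePiece2 p h xj x = splinePiece3 p h xj (2 * xj - x) := by
  simp only [splinePiece2, splinePiece3]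
  ring_nf

/-- First derivative of `splinePiece3`. -/
noncomputable def splinePiece3Deriv (p h xj x : ℝ) : ℝ :=
  bCoef p h + p * c1Coef p h * Real.exp (p * (x - xj)) -
    p * dCoef p h * Real.exp (-(p * (x - xj)))

/-- Second derivative of `splinePiece3`. -/
noncomputable def splinePiece3Deriv2 (p h xj x : ℝ) : ℝ :=
  p ^ 2 * (c1Coef p h * Real.exp (p * (x - xj)) + dCoef p h * Real.exp (-(p * (x - xj))))

/-- First derivative of `splinePiece4`. -/
noncomputable def splinePiece4Deriv (p h xj x : ℝ) : ℝ :=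
  eCoef p h * (1 - Real.cosh (p * (x - (xj + 2 * h))))

/-- Second derivative of `splinePiece4`. -/
noncomputable def splinePiece4Deriv2 (p h xj x : ℝ) : ℝ :=
  -(eCoef p h * p * Real.sinh (p * (x - (xj + 2 * h))))

theorem isTwoJet_splinePiece3 (p h xj : ℝ) :
    IsTwoJet (splinePiece3 p h xj) (splinePiece3Deriv p h xj) (splinePiece3Deriv2 p h xj) := by
  have hu (x : ℝ) : HasDerivAt (fun x => x - xj) 1 x := (hasDerivAt_id x).sub_const xj
  have hE (x : ℝ) := ((hu x).const_mul p).exp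
  have hE' (x : ℝ) := ((hu x).const_mul p).neg.exp
  refine ⟨fun x => ?_, fun x => ?_, ?_⟩
  · refine (((((hu x).const_mul (bCoef p h)).const_add (aCoef p h)).add
      ((hE x).const_mul (c1Coef p h))).add ((hE' x).const_mul (dCoef p h))).congr_deriv ?_
    simp only [splinePiece3Deriv, Pi.neg_apply]
    ring
  · refine ((((hE x).const_mul (p * c1Coef p h)).const_add (bCoef p h)).sub
      ((hE' x).const_mul (p * dCoef p h))).congr_deriv ?_
    simp only [splinePiece3Deriv2, Pi.neg_apply]
    ring
  · unfold splinePiece3Deriv2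
    fun_prop

theorem isTwoJet_splinePiece4 {p : ℝ} (hp : p ≠ 0) (h xj : ℝ) :
    IsTwoJet (splinePiece4 p h xj) (splinePiece4Deriv p h xj) (splinePiece4Deriv2 p h xj) := by
  have hu (x : ℝ) : HasDerivAt (fun x => x - (xj + 2 * h)) 1 x := (hasDerivAt_id x).sub_const _
  refine ⟨fun x => ?_, fun x => ?_, ?_⟩
  · refine (((hu x).const_mul (eCoef p h)).sub
      (((hu x).const_mul p).sinh.const_mul (eCoef p h / p))).congr_deriv ?_
    simp only [splinePiece4Deriv]
    field_simp
  · refine ((((hu x).const_mul p).cosh.const_sub 1).const_mul (eCoef p h)).congr_deriv ?_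
    simp only [splinePiece4Deriv2]
    ring
  · unfold splinePiece4Deriv2
    fun_prop

theorem Real.sinh_lt_self_mul_cosh {x : ℝ} (hx : 0 < x) : Real.sinh x < x * Real.cosh x := by
  have hd (y : ℝ) : HasDerivAt (fun y => y * Real.cosh y - Real.sinh y) (y * Real.sinh y) y :=
    (((hasDerivAt_id y).mul (Real.hasDerivAt_cosh y)).sub
      (Real.hasDerivAt_sinh y)).congr_deriv (by simp)
  have hmono : StrictMonoOn (fun y => y * Real.cosh y - Real.sinh y) (Set.Ici 0) := by
    refine strictMonoOn_of_deriv_pos (convex_Ici 0) (by fun_prop) fun y hy => ?_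
    rw [interior_Ici, Set.mem_Ioi] at hy
    rw [(hd y).deriv]
    exact mul_pos hy (Real.sinh_pos_iff.2 hy)
  simpa using hmono Set.self_mem_Ici hx.le hx

theorem splinePiece3Deriv_center (p h xj : ℝ) : splinePiece3Deriv p h xj xj = 0 := by
  have hs := Real.sinh_eq (p * h)
  have hc := Real.cosh_eq (p * h)
  have hE : Real.exp (p * h) = Real.cosh (p * h) + Real.sinh (p * h) := by linarith
  have hE' : Real.exp (-(p * h)) = Real.cosh (p * h) - Real.sinh (p * h) := by linarith
  simp only [splinePiece3Deriv, bCoef, c1Coef, dCoef, sub_self, mul_zero, neg_zero, Real.exp_zero,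
    hE, hE']
  ring

theorem splinePiece3_eq_splinePiece4_knot {p h : ℝ} (hp : 0 < p) (hh : 0 < h)
    (xj : ℝ) :
    splinePiece3 p h xj (xj + h) = splinePiece4 p h xj (xj + h) ∧
      splinePiece3Deriv p h xj (xj + h) = splinePiece4Deriv p h xj (xj + h) ∧
      splinePiece3Deriv2 p h xj (xj + h) = splinePiece4Deriv2 p h xj (xj + h) := by
  have hw : 0 < p * h := mul_pos hp hh
  have hs := Real.sinh_eq (p * h)
  have hc := Real.cosh_eq (p * h)
  have hE : Real.exp (p * h) = Real.cosh (p * h) + Real.sinh (p * h) := by linarith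
  have hE' : Real.exp (-(p * h)) = Real.cosh (p * h) - Real.sinh (p * h) := by linarith
  have hD : p * h * Real.cosh (p * h) - Real.sinh (p * h) ≠ 0 :=
    (sub_pos.2 (Real.sinh_lt_self_mul_cosh hw)).ne'
  have hm : 1 - Real.cosh (p * h) ≠ 0 := (sub_neg.2 (Real.one_lt_cosh.2 hw.ne')).ne
  have hsq := Real.cosh_sq (p * h)
  simp only [splinePiece3, splinePiece4, splinePiece3Deriv, splinePiece4Deriv, splinePiece3Deriv2,
    splinePiece4Deriv2, aCoef, bCoef, c1Coef, dCoef, eCoef, add_sub_cancel_left,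
    show xj + h - (xj + 2 * h) = -h by ring, mul_neg, Real.sinh_neg, Real.cosh_neg, hE, hE']
  generalize Real.sinh (p * h) = s at *
  generalize Real.cosh (p * h) = c at *
  generalize hDdef : p * h * c - s = D at *
  generalize hmdef : 1 - c = m at *
  refine ⟨?_, ?_, ?_⟩ <;> field_simp <;> grind

theorem expBSpline_eq_glueAt {p h : ℝ} (hh : 0 < h) (xj : ℝ)
    (h1 : splinePiece1 p h xj (xj - 2 * h) = 0) :
    expBSpline p h xj = glueAt (xj - 2 * h) (fun _ => 0) (glueAt (xj - h) (splinePiece1 p h xj)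
      (glueAt xj (splinePiece2 p h xj) (glueAt (xj + h) (splinePiece3 p h xj)
        (glueAt (xj + 2 * h) (splinePiece4 p h xj) (fun _ => 0))))) := by
  funext x
  unfold expBSpline glueAt
  by_cases hx : x = xj - 2 * h
  · subst hx
    rw [if_pos ⟨le_rfl, by linarith⟩, if_pos le_rfl, h1]
  · grind

/-- The exponential B-spline is well defined — the four pieces agree at the overlapping
knots (and vanish at the endpoints `x_{j±2}` of its support) — and it is twice
continuously differentiable on all of `ℝ`. -/
theorem expBSpline_wellDefined_contDiff (p h xj : ℝ) (hp : 0 < p) (hh : 0 < h) :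
    (splinePiece1 p h xj (xj - 2 * h) = 0 ∧
     splinePiece1 p h xj (xj - h) = splinePiece2 p h xj (xj - h) ∧
     splinePiece2 p h xj xj = splinePiece3 p h xj xj ∧
     splinePiece3 p h xj (xj + h) = splinePiece4 p h xj (xj + h) ∧
     splinePiece4 p h xj (xj + 2 * h) = 0) ∧
    ContDiff ℝ 2 (expBSpline p h xj) := by
  have h23 : splinePiece2 p h xj xj = splinePiece3 p h xj xj := by
    rw [splinePiece2_eq]; ring_nf
  have h4 : splinePiece4 p h xj (xj + 2 * h) = 0 := by simp [splinePiece4]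
  have h4' : splinePiece4Deriv p h xj (xj + 2 * h) = 0 := by simp [splinePiece4Deriv]
  have h4'' : splinePiece4Deriv2 p h xj (xj + 2 * h) = 0 := by simp [splinePiece4Deriv2]
  obtain ⟨h34, h34', h34''⟩ := splinePiece3_eq_splinePiece4_knot hp hh xj
  have r0 : 2 * xj - xj = xj := by ring
  have r1 : 2 * xj - (xj - h) = xj + h := by ring
  have r2 : 2 * xj - (xj - 2 * h) = xj + 2 * h := by ring
  have h1 : splinePiece1 p h xj (xj - 2 * h) = 0 := by rw [splinePiece1_eq, r2, h4]
  have h12 : splinePiece1 p h xj (xj - h) = splinePiece2 p h xj (xj - h) := by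
    rw [splinePiece1_eq, splinePiece2_eq, r1, h34]
  refine ⟨⟨h1, h12, h23, h34, h4⟩, ?_⟩
  have j3 := isTwoJet_splinePiece3 p h xj
  have j4 := isTwoJet_splinePiece4 hp.ne' h xj
  have j1 := j4.comp_const_sub (2 * xj)
  have j2 := j3.comp_const_sub (2 * xj)
  simp only [← splinePiece1_eq] at j1
  simp only [← splinePiece2_eq] at j2
  rw [expBSpline_eq_glueAt hh xj h1]
  have k1 : xj - 2 * h ≤ xj - h := by linarith
  have k2 : xj - h ≤ xj := by linarith
  have k3 : xj ≤ xj + h := by linarith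
  have k4 : xj + h ≤ xj + 2 * h := by linarith
  refine (IsTwoJet.zero.glue (j1.glue (j2.glue (j3.glue (j4.glue .zero h4 h4' h4'')
    ?_ ?_ ?_) ?_ ?_ ?_) ?_ ?_ ?_) ?_ ?_ ?_).contDiff <;>
  simp [glueAt_of_le, k1, k2, k3, k4, r0, r1, r2, h1, h12, h23, h34, h34', h34'', h4', h4'',
    splinePiece3Deriv_center]
end

section
/- Let μ > 0, let N be a positive natural number, let 0 ≤ i ≤ N − 1, and let b_i be the Block-Pulse function b_i(ξ) = 1 for i/N ≤ ξ < (i+1)/N and 0 otherwise. Then for every t ≥ 0, the Riemann–Liouville fractional integral of b_i is given exactly by (1/Γ(μ)) ∫₀ᵗ (t − ξ)^{μ−1} b_i(ξ) dξ = [max(t − i/N, 0)^μ − max(t − (i+1)/N, 0)^μ]/Γ(μ+1). -/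
open scoped Classical in
/-- The `i`-th Block-Pulse function of the `N`-set: equal to `1` on `[i/N, (i+1)/N)`
and `0` otherwise. -/
noncomputable def blockPulse (N i : ℕ) (ξ : ℝ) : ℝ :=
  if (i : ℝ) / N ≤ ξ ∧ ξ < ((i : ℝ) + 1) / N then 1 else 0

open MeasureTheory in
/-- Integrating against the indicator of `[a, b)` truncates the interval of integration. -/
lemma intervalIntegral_indicator_Ico (f : ℝ → ℝ) {a b t : ℝ} (ha : 0 ≤ a) (hab : a ≤ b)
    (ht : 0 ≤ t) :
    ∫ ξ in (0:ℝ)..t, (Set.Ico a b).indicator f ξ = ∫ ξ in (min a t)..(min b t), f ξ := by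
  have hset : Set.Ioc 0 t ∩ Set.Ioc a b = Set.Ioc (min a t) (min b t) := by
    ext x
    simp only [Set.mem_inter_iff, Set.mem_Ioc, min_lt_iff, le_min_iff]
    constructor
    · rintro ⟨⟨_, h₂⟩, h₃, h₄⟩
      exact ⟨Or.inl h₃, h₄, h₂⟩
    · rintro ⟨h₁ | h₁, h₂, h₃⟩
      · exact ⟨⟨by linarith, h₃⟩, h₁, h₂⟩
      · exact absurd h₁ (not_lt.mpr h₃)
  rw [intervalIntegral.integral_of_le ht,
    intervalIntegral.integral_of_le (min_le_min_right t hab),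
    setIntegral_indicator measurableSet_Ico, ← hset]
  exact setIntegral_congr_set ((Filter.EventuallyEq.refl _ _).inter Ico_ae_eq_Ioc)

lemma sub_min_eq_max_sub_zero (a t : ℝ) : t - min a t = max (t - a) 0 := by
  rcases le_total a t with h | h
  · rw [min_eq_left h, max_eq_left (sub_nonneg.mpr h)]
  · rw [min_eq_right h, max_eq_right (sub_nonpos.mpr h), sub_self]

/-- The unnormalised Riemann–Liouville integral of the indicator of `[a, b)`. -/
lemma integral_sub_rpow_mul_indicator_Ico {μ a b t : ℝ} (hμ : 0 < μ) (ha : 0 ≤ a)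
    (hab : a ≤ b) (ht : 0 ≤ t) :
    ∫ ξ in (0:ℝ)..t, (Set.Ico a b).indicator (fun ξ => (t - ξ) ^ (μ - 1)) ξ
      = (max (t - a) 0 ^ μ - max (t - b) 0 ^ μ) / μ := by
  rw [intervalIntegral_indicator_Ico _ ha hab ht,
    intervalIntegral.integral_comp_sub_left (fun x : ℝ => x ^ (μ - 1)) t,
    integral_rpow (Or.inl (by linarith)), sub_add_cancel,
    sub_min_eq_max_sub_zero, sub_min_eq_max_sub_zero]

/-- Exact Riemann–Liouville fractional integral of order `μ > 0` of a Block-Pulse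
function: `(1/Γ(μ)) ∫₀ᵗ (t-ξ)^(μ-1) bᵢ(ξ) dξ
  = (max(t - i/N, 0)^μ - max(t - (i+1)/N, 0)^μ)/Γ(μ+1)` for every `t ≥ 0`. -/
theorem riemannLiouville_blockPulse (μ : ℝ) (hμ : 0 < μ)
    (N : ℕ) (hN : 0 < N) (i : ℕ) (hi : i ≤ N - 1) :
    ∀ t : ℝ, 0 ≤ t →
      (1 / Real.Gamma μ) * ∫ ξ in (0:ℝ)..t, (t - ξ) ^ (μ - 1) * blockPulse N i ξ
        = (max (t - (i : ℝ) / N) 0 ^ μ - max (t - ((i : ℝ) + 1) / N) 0 ^ μ) /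
            Real.Gamma (μ + 1) := by
  intro t ht
  have hab : (i : ℝ) / N ≤ ((i : ℝ) + 1) / N := by gcongr; linarith
  have hfun : (fun ξ : ℝ => (t - ξ) ^ (μ - 1) * blockPulse N i ξ) =
      (Set.Ico ((i : ℝ) / N) (((i : ℝ) + 1) / N)).indicator (fun ξ => (t - ξ) ^ (μ - 1)) := by
    ext ξ
    simp [blockPulse, Set.indicator_apply]
  rw [hfun, integral_sub_rpow_mul_indicator_Ico hμ (by positivity) hab ht,
    Real.Gamma_add_one hμ.ne']
  have hΓ := (Real.Gamma_pos_of_pos hμ).ne'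
  field_simp
end

section
/- Let μ > 0, let N be a positive natural number, and let 0 ≤ i ≤ j ≤ N − 1 with b_i the Block-Pulse function on [i/N, (i+1)/N). Then the local average of the Riemann–Liouville fractional integral J^(μ)b_i over the j-th block equals the corresponding entry of the Block-Pulse operational matrix of fractional integration: N ∫_{j/N}^{(j+1)/N} J^(μ)b_i(t) dt = ξ_{j−i} / (N^μ Γ(μ+2)), where ξ_0 = 1 and ξ_k = (k+1)^{μ+1} − 2k^{μ+1} + (k−1)^{μ+1} for k ≥ 1; moreover N ∫_{j/N}^{(j+1)/N} J^(μ)b_i(t) dt = 0 whenever 0 ≤ j < i ≤ N − 1. -/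
/-- The Riemann–Liouville fractional integral of order `μ > 0`:
`J^(μ)f(t) = (1/Γ(μ)) ∫₀ᵗ (t-ξ)^(μ-1) f(ξ) dξ`. -/
noncomputable def rlIntegral (μ : ℝ) (f : ℝ → ℝ) (t : ℝ) : ℝ :=
  (1 / Real.Gamma μ) * ∫ ξ in (0:ℝ)..t, (t - ξ) ^ (μ - 1) * f ξ

/-- The sequence `ξ₀ = 1` and `ξ_k = (k+1)^(μ+1) - 2k^(μ+1) + (k-1)^(μ+1)` for `k ≥ 1`
appearing in the Block-Pulse operational matrix of fractional integration. -/
noncomputable def xiSeq (μ : ℝ) (k : ℕ) : ℝ :=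
  if k = 0 then 1
  else ((k : ℝ) + 1) ^ (μ + 1) - 2 * (k : ℝ) ^ (μ + 1) + ((k : ℝ) - 1) ^ (μ + 1)

theorem intervalIntegrable_sub_rpow {μ : ℝ} (hμ : 0 < μ) (t a b : ℝ) :
    IntervalIntegrable (fun ξ : ℝ => (t - ξ) ^ (μ - 1)) MeasureTheory.volume a b := by
  have h := (intervalIntegral.intervalIntegrable_rpow' (a := t - a) (b := t - b)
    (r := μ - 1) (by linarith)).comp_sub_left t
  simpa using h

theorem integral_sub_rpow {μ : ℝ} (hμ : 0 < μ) (t a : ℝ) :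
    ∫ ξ in a..t, (t - ξ) ^ (μ - 1) = (t - a) ^ μ / μ := by
  rw [intervalIntegral.integral_comp_sub_left (fun x : ℝ => x ^ (μ - 1)) t,
    integral_rpow (Or.inl (by linarith))]
  simp [Real.zero_rpow hμ.ne']

theorem intervalIntegrable_indicator_Ici_sub_rpow {μ : ℝ} (hμ : 0 < μ) (t a b c : ℝ) :
    IntervalIntegrable ((Set.Ici a).indicator fun ξ : ℝ => (t - ξ) ^ (μ - 1))
      MeasureTheory.volume b c :=
  ⟨(intervalIntegrable_sub_rpow hμ t b c).1.indicator measurableSet_Ici,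
    (intervalIntegrable_sub_rpow hμ t b c).2.indicator measurableSet_Ici⟩

theorem integral_indicator_Ici_eq_zero {f : ℝ → ℝ} {a b c : ℝ} (hbc : b ≤ c) (hca : c ≤ a) :
    ∫ ξ in b..c, (Set.Ici a).indicator f ξ = 0 := by
  rw [intervalIntegral.integral_of_le hbc, MeasureTheory.integral_Ioc_eq_integral_Ioo]
  refine MeasureTheory.setIntegral_eq_zero_of_forall_eq_zero fun ξ hξ => ?_
  exact Set.indicator_of_notMem (fun h => absurd h (not_le.2 (hξ.2.trans_le hca))) _

theorem integral_indicator_Ici_sub_rpow {μ t a : ℝ} (hμ : 0 < μ) (ht : 0 ≤ t) (ha : 0 ≤ a) :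
    ∫ ξ in (0 : ℝ)..t, (Set.Ici a).indicator (fun ξ : ℝ => (t - ξ) ^ (μ - 1)) ξ
      = max (t - a) 0 ^ μ / μ := by
  rcases le_total t a with hta | hat
  · rw [integral_indicator_Ici_eq_zero ht hta, max_eq_right (by linarith),
      Real.zero_rpow hμ.ne', zero_div]
  · rw [← intervalIntegral.integral_add_adjacent_intervals
      (intervalIntegrable_indicator_Ici_sub_rpow hμ t a 0 a)
      (intervalIntegrable_indicator_Ici_sub_rpow hμ t a a t),
      integral_indicator_Ici_eq_zero ha le_rfl, zero_add, max_eq_left (by linarith),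
      ← integral_sub_rpow hμ]
    refine intervalIntegral.integral_congr fun ξ hξ => ?_
    rw [Set.uIcc_of_le hat] at hξ
    exact Set.indicator_of_mem (Set.mem_Ici.2 hξ.1) _

theorem rlIntegral_blockPulse {μ t : ℝ} (hμ : 0 < μ) (N i : ℕ) (ht : 0 ≤ t) :
    rlIntegral μ (blockPulse N i) t
      = 1 / Real.Gamma μ * (max (t - (i : ℝ) / N) 0 ^ μ / μ
          - max (t - ((i + 1 : ℕ) : ℝ) / N) 0 ^ μ / μ) := by
  rw [rlIntegral, ← integral_indicator_Ici_sub_rpow hμ ht (by positivity),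
    ← integral_indicator_Ici_sub_rpow hμ ht (by positivity),
    ← intervalIntegral.integral_sub
      (intervalIntegrable_indicator_Ici_sub_rpow hμ t _ 0 t)
      (intervalIntegrable_indicator_Ici_sub_rpow hμ t _ 0 t)]
  congr 1
  refine intervalIntegral.integral_congr fun ξ _ => ?_
  have hle : (i : ℝ) / N ≤ ((i : ℝ) + 1) / N := by gcongr; linarith
  by_cases h₁ : (i : ℝ) / N ≤ ξ <;> by_cases h₂ : ((i : ℝ) + 1) / N ≤ ξ
  · simp [blockPulse, h₁, h₂]
  · simp [blockPulse, h₁, h₂, not_le.1 h₂]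
  · exact absurd (hle.trans h₂) h₁
  · simp [blockPulse, h₁, h₂]

theorem integral_max_sub_rpow {μ : ℝ} (hμ : 0 < μ) {N : ℕ} (hN : 0 < N) (i j : ℕ) :
    ∫ t in ((j : ℝ) / N)..(((j : ℝ) + 1) / N), max (t - (i : ℝ) / N) 0 ^ μ
      = (max ((j : ℝ) + 1 - i) 0 ^ (μ + 1) - max ((j : ℝ) - i) 0 ^ (μ + 1))
          / ((N : ℝ) ^ (μ + 1) * (μ + 1)) := by
  have hN' : (0 : ℝ) < N := by exact_mod_cast hN
  have hjj : (j : ℝ) / N ≤ ((j : ℝ) + 1) / N := by gcongr; linarith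
  have hμ' : μ + 1 ≠ 0 := by positivity
  rcases lt_or_ge j i with hji | hij
  · have h : (j : ℝ) + 1 ≤ i := by exact_mod_cast hji
    rw [max_eq_right (by linarith), max_eq_right (by linarith), sub_self, zero_div]
    refine (intervalIntegral.integral_congr fun t ht => ?_).trans intervalIntegral.integral_zero
    rw [Set.uIcc_of_le hjj] at ht
    have : ((j : ℝ) + 1) / N ≤ (i : ℝ) / N := by gcongr
    simp only [max_eq_right (sub_nonpos.2 (ht.2.trans this)), Real.zero_rpow hμ.ne']
  · have h : (i : ℝ) ≤ j := by exact_mod_cast hij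
    rw [max_eq_left (by linarith), max_eq_left (by linarith)]
    have hcongr : ∫ t in ((j : ℝ) / N)..(((j : ℝ) + 1) / N), max (t - (i : ℝ) / N) 0 ^ μ
        = ∫ t in ((j : ℝ) / N)..(((j : ℝ) + 1) / N), (t - (i : ℝ) / N) ^ μ := by
      refine intervalIntegral.integral_congr fun t ht => ?_
      rw [Set.uIcc_of_le hjj] at ht
      have : (i : ℝ) / N ≤ (j : ℝ) / N := by gcongr
      simp only [max_eq_left (sub_nonneg.2 (this.trans ht.1))]
    rw [hcongr, intervalIntegral.integral_comp_sub_right (fun x : ℝ => x ^ μ),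
      integral_rpow (Or.inl (by linarith)), ← sub_div, ← sub_div,
      Real.div_rpow (by linarith) hN'.le, Real.div_rpow (by linarith) hN'.le, ← sub_div, div_div]

theorem average_rlIntegral_blockPulse {μ : ℝ} (hμ : 0 < μ) {N : ℕ} (hN : 0 < N) (i j : ℕ) :
    (N : ℝ) * ∫ t in ((j : ℝ) / N)..(((j : ℝ) + 1) / N), rlIntegral μ (blockPulse N i) t
      = (max ((j : ℝ) - i + 1) 0 ^ (μ + 1) - 2 * max ((j : ℝ) - i) 0 ^ (μ + 1)
          + max ((j : ℝ) - i - 1) 0 ^ (μ + 1)) / ((N : ℝ) ^ μ * Real.Gamma (μ + 2)) := by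
  have hN' : (0 : ℝ) < N := by exact_mod_cast hN
  have hjj : (j : ℝ) / N ≤ ((j : ℝ) + 1) / N := by gcongr; linarith
  have hint (k : ℕ) : IntervalIntegrable (fun t : ℝ => max (t - (k : ℝ) / N) 0 ^ μ / μ)
      MeasureTheory.volume ((j : ℝ) / N) (((j : ℝ) + 1) / N) := by
    refine Continuous.intervalIntegrable ?_ _ _
    exact (Continuous.rpow_const (by fun_prop) fun _ => Or.inr hμ.le).div_const μ
  have hcongr : ∫ t in ((j : ℝ) / N)..(((j : ℝ) + 1) / N), rlIntegral μ (blockPulse N i) t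
      = ∫ t in ((j : ℝ) / N)..(((j : ℝ) + 1) / N),
          1 / Real.Gamma μ * (max (t - (i : ℝ) / N) 0 ^ μ / μ
            - max (t - ((i + 1 : ℕ) : ℝ) / N) 0 ^ μ / μ) := by
    refine intervalIntegral.integral_congr fun t ht => ?_
    rw [Set.uIcc_of_le hjj] at ht
    exact rlIntegral_blockPulse hμ N i (le_trans (by positivity) ht.1)
  have hΓ : Real.Gamma (μ + 2) = (μ + 1) * (μ * Real.Gamma μ) := by
    rw [← Real.Gamma_add_one hμ.ne', ← Real.Gamma_add_one (by positivity)]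
    congr 1
    ring
  have hΓ0 : Real.Gamma μ ≠ 0 := (Real.Gamma_pos_of_pos hμ).ne'
  have hNμ : (N : ℝ) ^ μ ≠ 0 := (Real.rpow_pos_of_pos hN' μ).ne'
  rw [hcongr, intervalIntegral.integral_const_mul, intervalIntegral.integral_sub (hint _) (hint _),
    intervalIntegral.integral_div, intervalIntegral.integral_div, integral_max_sub_rpow hμ hN,
    integral_max_sub_rpow hμ hN, hΓ, Real.rpow_add_one hN'.ne']
  have e₁ : (j : ℝ) + 1 - i = j - i + 1 := by ring
  have e₂ : (j : ℝ) + 1 - (i + 1 : ℕ) = j - i := by push_cast; ring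
  have e₃ : (j : ℝ) - (i + 1 : ℕ) = j - i - 1 := by push_cast; ring
  rw [e₁, e₂, e₃]
  have hμ1 : μ + 1 ≠ 0 := by positivity
  field_simp
  ring

/-- The local average of `J^(μ)bᵢ` over the `j`-th block equals the `(i,j)` entry of
the Block-Pulse operational matrix of fractional integration:
`N ∫_{j/N}^{(j+1)/N} J^(μ)bᵢ(t) dt = ξ_{j-i}/(N^μ Γ(μ+2))` for `i ≤ j ≤ N-1`, and it
vanishes for `j < i ≤ N-1`. -/
theorem blockPulse_operational_matrix (μ : ℝ) (hμ : 0 < μ) (N : ℕ) (hN : 0 < N) :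
    (∀ i j : ℕ, i ≤ j → j ≤ N - 1 →
      (N : ℝ) * ∫ t in ((j : ℝ) / N)..(((j : ℝ) + 1) / N), rlIntegral μ (blockPulse N i) t
        = xiSeq μ (j - i) / ((N : ℝ) ^ μ * Real.Gamma (μ + 2))) ∧
    (∀ i j : ℕ, j < i → i ≤ N - 1 →
      (N : ℝ) * ∫ t in ((j : ℝ) / N)..(((j : ℝ) + 1) / N), rlIntegral μ (blockPulse N i) t
        = 0) := by
  have hμ1 : μ + 1 ≠ 0 := by positivity
  refine ⟨fun i j hij _ => ?_, fun i j hji _ => ?_⟩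
  · obtain ⟨k, rfl⟩ := Nat.exists_eq_add_of_le hij
    have e : ((i + k : ℕ) : ℝ) - i = k := by push_cast; ring
    rw [average_rlIntegral_blockPulse hμ hN, e, Nat.add_sub_cancel_left, xiSeq]
    congr 1
    rcases Nat.eq_zero_or_pos k with rfl | hk
    · simp [Real.zero_rpow hμ1]
    · have hk' : (1 : ℝ) ≤ k := by exact_mod_cast hk
      rw [if_neg hk.ne', max_eq_left (by linarith), max_eq_left (by linarith),
        max_eq_left (by linarith)]
  · have h : (j : ℝ) + 1 ≤ i := by exact_mod_cast hji
    rw [average_rlIntegral_blockPulse hμ hN, max_eq_right (by linarith),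
      max_eq_right (by linarith), max_eq_right (by linarith), Real.zero_rpow hμ1]
    simp
end
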